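/- Let G be a connected finite simple graph and k ≥ 2 an integer. Let S ⊆ V(G) satisfy α_G(S) ≤ k + κ_G(S) − 1. Then G has a tree T covering S with at most k − 2 branch vertices (vertices of degree at least three in T). -/

import Mathlib

open SimpleGraph Set

variable {V : Type*}

/-- The independence number of `S` in `G`: the maximum cardinality of a subset of `S`
that is independent in `G`. -/
noncomputable def indepNumOn (G : SimpleGraph V) (S : Set V) : ℕ :=
  sSup {n | ∃ I : Set V, I ⊆ S ∧ I.Pairwise (fun a b => ¬ G.Adj a b) ∧ I.ncard = n}

/-- `I` is a maximum independent subset of `S` in `G`. -/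
def MaxIndepOn (G : SimpleGraph V) (S : Set V) (I : Set V) : Prop :=
  I ⊆ S ∧ I.Pairwise (fun a b => ¬ G.Adj a b) ∧ I.ncard = indepNumOn G S

/-- Two `x`–`y` walks are internally disjoint if they share only `x` and `y`. -/
def InternallyDisjoint (G : SimpleGraph V) {x y : V} (p q : G.Walk x y) : Prop :=
  ∀ v, v ∈ p.support → v ∈ q.support → v = x ∨ v = y

/-- Local connectivity `κ_G(x,y)`: maximum number of pairwise internally disjoint
`x`–`y` paths in `G`. -/
noncomputable def localConn (G : SimpleGraph V) (x y : V) : ℕ :=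
  sSup {n | ∃ P : Set (G.Path x y),
    P.Pairwise (fun p q => InternallyDisjoint G p.1 q.1) ∧ P.ncard = n}

/-- `κ_G(S)`: the minimum of local connectivities over distinct pairs in `S`,
`+∞` if `S` has at most one element. -/
noncomputable def setConn (G : SimpleGraph V) (S : Set V) : ℕ∞ :=
  ⨅ x ∈ S, ⨅ y ∈ S, ⨅ _ : x ≠ y, (localConn G x y : ℕ∞)

/-- Vertex connectivity `κ(G)`: the maximum `k` such that `G` has more than `k`
vertices and removing fewer than `k` vertices always leaves a connected graph. -/
noncomputable def vertexConn (G : SimpleGraph V) [Fintype V] : ℕ :=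
  sSup {k | k < Fintype.card V ∧ ∀ X : Finset V, X.card < k →
    (G.induce ((↑X : Set V)ᶜ)).Connected}

/-- The set of leaves (vertices of degree one) of a subgraph. -/
def subLeaves {G : SimpleGraph V} (T : G.Subgraph) : Set V :=
  {v | v ∈ T.verts ∧ (T.neighborSet v).ncard = 1}

/-- The set of branch vertices (vertices of degree at least three) of a subgraph. -/
def subBranches {G : SimpleGraph V} (T : G.Subgraph) : Set V :=
  {v | v ∈ T.verts ∧ 3 ≤ (T.neighborSet v).ncard}


theorem indep_ncard_le [Finite V] {G : SimpleGraph V} {A I : Set V} (hI : I ⊆ A)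
    (hp : I.Pairwise fun a b => ¬ G.Adj a b) : I.ncard ≤ indepNumOn G A := by
  refine le_csSup ⟨Nat.card V, ?_⟩ ⟨I, hI, hp, rfl⟩
  rintro n ⟨J, -, -, rfl⟩
  exact Set.ncard_le_card J

theorem exists_maxIndepOn [Finite V] (G : SimpleGraph V) (A : Set V) :
    ∃ I, MaxIndepOn G A I := by
  have h : indepNumOn G A ∈ {n | ∃ I : Set V, I ⊆ A ∧
      I.Pairwise (fun a b => ¬ G.Adj a b) ∧ I.ncard = n} := by
    refine Nat.sSup_mem ⟨0, ∅, by simp⟩ ⟨Nat.card V, ?_⟩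
    rintro n ⟨J, -, -, rfl⟩
    exact Set.ncard_le_card J
  exact h

theorem indepNumOn_mono [Finite V] {G : SimpleGraph V} {A B : Set V} (h : A ⊆ B) :
    indepNumOn G A ≤ indepNumOn G B := by
  obtain ⟨I, hI, hp, hc⟩ := exists_maxIndepOn G A
  exact hc ▸ indep_ncard_le (hI.trans h) hp

theorem indepNumOn_union_le [Finite V] (G : SimpleGraph V) (A B : Set V) :
    indepNumOn G (A ∪ B) ≤ indepNumOn G A + indepNumOn G B := by
  obtain ⟨I, hI, hp, hc⟩ := exists_maxIndepOn G (A ∪ B)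
  have h1 := indep_ncard_le (G := G) (inter_subset_right : I ∩ A ⊆ A) (hp.mono inter_subset_left)
  have h2 := indep_ncard_le (G := G) (inter_subset_right : I ∩ B ⊆ B) (hp.mono inter_subset_left)
  have h3 : I = (I ∩ A) ∪ (I ∩ B) := by
    rw [← inter_union_distrib_left, inter_eq_left.2 hI]
  have h4 := Set.ncard_union_le (I ∩ A) (I ∩ B)
  rw [← h3] at h4
  omega

theorem indepNumOn_add_le [Finite V] {G : SimpleGraph V} {A B : Set V} (hd : Disjoint A B)
    (hAB : ∀ a ∈ A, ∀ b ∈ B, ¬ G.Adj a b) :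
    indepNumOn G A + indepNumOn G B ≤ indepNumOn G (A ∪ B) := by
  obtain ⟨I, hI, hp, hc⟩ := exists_maxIndepOn G A
  obtain ⟨J, hJ, hq, hd'⟩ := exists_maxIndepOn G B
  rw [← hc, ← hd', ← Set.ncard_union_eq (hd.mono hI hJ)]
  refine indep_ncard_le (union_subset_union hI hJ) ?_
  rw [Set.pairwise_union]
  exact ⟨hp, hq, fun a ha b hb _ =>
    ⟨hAB a (hI ha) b (hJ hb), fun h => hAB a (hI ha) b (hJ hb) h.symm⟩⟩

theorem indepNumOn_singleton_le (G : SimpleGraph V) [Finite V] (v : V) :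
    indepNumOn G {v} ≤ 1 := by
  obtain ⟨I, hI, -, hc⟩ := exists_maxIndepOn G {v}
  rw [← hc]
  simpa using Set.ncard_le_ncard hI

theorem indepNumOn_modular [Finite V] {G : SimpleGraph V} {W A B C : Set V} (hC : C ⊆ W)
    (hAB : Disjoint A B) (hWA : Disjoint W A) (hWB : Disjoint W B)
    (hE : ∀ a ∈ A ∪ C, ∀ b ∈ B ∪ (W \ C), ¬ G.Adj a b) :
    indepNumOn G (W ∪ (A ∪ B)) + indepNumOn G W =
      indepNumOn G (W ∪ A) + indepNumOn G (W ∪ B) := by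
  have hCA := hWA.mono_left hC
  have hCB := hWB.mono_left hC
  have hDA : Disjoint (W \ C) A := hWA.mono_left sdiff_subset
  have hDB : Disjoint (W \ C) B := hWB.mono_left sdiff_subset
  have hCD : Disjoint C (W \ C) := disjoint_sdiff_right
  have hW : W = C ∪ (W \ C) := (union_sdiff_cancel hC).symm
  have hWA' : W ∪ A = (A ∪ C) ∪ (W \ C) := by rw [union_assoc, ← hW, union_comm]
  have hWB' : W ∪ B = C ∪ (B ∪ (W \ C)) := by rw [union_left_comm, ← hW, union_comm]
  have hWAB : W ∪ (A ∪ B) = (A ∪ C) ∪ (B ∪ (W \ C)) := by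
    rw [union_union_union_comm, ← hW, union_comm]
  have key : ∀ X Y : Set V, X ⊆ A ∪ C → Y ⊆ B ∪ (W \ C) →
      indepNumOn G (X ∪ Y) = indepNumOn G X + indepNumOn G Y := by
    intro X Y hX hY
    refine le_antisymm (indepNumOn_union_le G X Y) (indepNumOn_add_le ?_ ?_)
    · refine Disjoint.mono hX hY ?_
      simp only [disjoint_union_left, disjoint_union_right]
      exact ⟨⟨hAB, hCB⟩, hDA.symm, hCD⟩
    · exact fun a ha b hb => hE a (hX ha) b (hY hb)
  have h1 := key (A ∪ C) (B ∪ (W \ C)) subset_rfl subset_rfl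
  have h2 := key (A ∪ C) (W \ C) subset_rfl subset_union_right
  have h3 := key C (B ∪ (W \ C)) subset_union_right subset_rfl
  have h4 := key C (W \ C) subset_union_right subset_union_right
  rw [← hWAB] at h1
  rw [← hWA'] at h2
  rw [← hWB'] at h3
  rw [← hW] at h4
  omega

theorem SimpleGraph.Walk.IsPath.exists_support_eq {G : SimpleGraph V} {a b : V}
    {w : G.Walk a b} (hw : w.IsPath) (hab : a ≠ b) :
    ∃ Q : List V, w.support = a :: (Q ++ [b]) ∧ a ∉ Q ∧ b ∉ Q ∧ Q.Nodup ∧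
      List.IsChain G.Adj (a :: (Q ++ [b])) := by
  have hn := hw.support_nodup
  have hc := w.isChain_adj_support
  cases w with
  | nil => exact absurd rfl hab
  | cons h w =>
    have hne := w.support_ne_nil
    have hl : w.support = w.support.dropLast ++ [b] := by
      conv_lhs => rw [← List.dropLast_append_getLast hne]
      simp
    refine ⟨w.support.dropLast, ?_⟩
    rw [Walk.support_cons, hl] at hn hc
    refine ⟨by rw [Walk.support_cons, ← hl], ?_, ?_, ?_, hc⟩ <;>
      simp at hn <;> grind

/-- If `A` and `B` are joined by no path whose interior lies in `W`, then the independence number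
is modular on `W ∪ A` and `W ∪ B`. -/
theorem exists_link_or_modular [Finite V] (G : SimpleGraph V) {W A B : Set V}
    (hAB : Disjoint A B) (hWA : Disjoint W A) (hWB : Disjoint W B) :
    (∃ a ∈ A, ∃ b ∈ B, ∃ Q : List V, (∀ v ∈ Q, v ∈ W) ∧ Q.Nodup ∧
      List.IsChain G.Adj (a :: (Q ++ [b]))) ∨
    indepNumOn G (W ∪ (A ∪ B)) + indepNumOn G W =
      indepNumOn G (W ∪ A) + indepNumOn G (W ∪ B) := by
  classical
  by_cases hlink : ∃ a ∈ A, ∃ b ∈ B, ∃ w : G.Walk a b, ∀ v ∈ w.support, v = a ∨ v ∈ W ∨ v = b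
  · left
    obtain ⟨a, ha, b, hb, w, hw⟩ := hlink
    have hne : a ≠ b := fun h => Set.disjoint_left.1 hAB ha (h ▸ hb)
    obtain ⟨Q, hQ, haQ, hbQ, hn, hc⟩ := w.bypass_isPath.exists_support_eq hne
    refine ⟨a, ha, b, hb, Q, fun v hv => ?_, hn, hc⟩
    have h1 : v ∈ w.support := w.support_bypass_subset_support (by rw [hQ]; simp [hv])
    rcases hw v h1 with rfl | h | rfl
    · exact absurd hv haQ
    · exact h
    · exact absurd hv hbQ
  · right
    push Not at hlink
    refine indepNumOn_modular
      (C := {c | c ∈ W ∧ ∃ a ∈ A, ∃ w : G.Walk a c, ∀ v ∈ w.support, v = a ∨ v ∈ W})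
      (fun c hc => hc.1) hAB hWA hWB ?_
    intro s hs t ht hst
    have h1 : ∃ a ∈ A, ∃ w : G.Walk a s, ∀ v ∈ w.support, v = a ∨ v ∈ W := by
      rcases hs with hs | hs
      · exact ⟨s, hs, Walk.nil, by simp⟩
      · exact hs.2
    obtain ⟨a, ha, w, hw⟩ := h1
    rcases ht with ht | ht
    · obtain ⟨v, hv, hv1, hv2, hv3⟩ := hlink a ha t ht (w.concat hst)
      rw [Walk.support_concat] at hv
      grind
    · refine ht.2 ⟨ht.1, a, ha, w.concat hst, fun v hv => ?_⟩
      rw [Walk.support_concat] at hv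
      have := ht.1
      grind

/-- `l` lists the vertices of a path of `G` that starts at `z`. -/
def IsPathFrom (G : SimpleGraph V) (z : V) (l : List V) : Prop :=
  l.head? = some z ∧ l.IsChain G.Adj ∧ l.Nodup

/-- The vertices of `S` other than `y` that the list `p` misses. -/
def residue (S : Set V) (y : V) (p : List V) : Set V :=
  {v | v ∈ S ∧ v ≠ y ∧ v ∉ p}

/-- The path `p` misses only a set of independence number less than `m` in `S \ {y}`, while no
path from `z` misses such a set in `S`. -/
structure IsCritical (G : SimpleGraph V) (z : V) (S : Set V) (y : V) (p : List V) (m : ℕ) :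
    Prop where
  path : IsPathFrom G z p
  notMem : y ∉ p
  mem : y ∈ S
  lt : indepNumOn G (residue S y p) < m
  le : ∀ l, IsPathFrom G z l → m ≤ indepNumOn G {v | v ∈ S ∧ v ∉ l}

/-- The paths with vertex list `e i :: F i ++ [y]` form a fan from `y` to the path `p`. -/
structure IsFan (G : SimpleGraph V) (y : V) (p : List V) {N : ℕ} (e : Fin N → V)
    (F : Fin N → List V) : Prop where
  inj : Function.Injective e
  mem : ∀ i, e i ∈ p
  chain : ∀ i, List.IsChain G.Adj (e i :: (F i ++ [y]))
  nodup : ∀ i, (F i).Nodup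
  notMem : ∀ i, y ∉ F i
  avoid : ∀ i, ∀ v ∈ F i, v ∉ p
  disj : ∀ i j, i ≠ j → ∀ v ∈ F i, v ∉ F j

theorem isChain_adj_reverse {G : SimpleGraph V} {l : List V} (h : l.IsChain G.Adj) :
    l.reverse.IsChain G.Adj := by
  rw [List.isChain_reverse]
  exact h.imp fun _ _ => SimpleGraph.Adj.symm

theorem isChain_cons_append_cons_iff {R : V → V → Prop} {u x : V} (M C : List V) :
    List.IsChain R (u :: (M ++ x :: C)) ↔
      List.IsChain R (u :: (M ++ [x])) ∧ List.IsChain R (x :: C) := by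
  rw [← List.cons_append, List.isChain_split, List.cons_append]

theorem head?_append_cons_eq {A B C : List V} {u z : V} (h : (A ++ u :: B).head? = some z) :
    (A ++ u :: C).head? = some z := by
  cases A <;> simpa using h

/-- Two ways of splitting a duplicate-free list at the same element agree. -/
theorem List.Nodup.append_cons_inj {A B A' B' : List V} {u : V}
    (hn : (A ++ u :: B).Nodup) (h : A ++ u :: B = A' ++ u :: B') : A = A' ∧ B = B' := by
  have hn' := h ▸ hn
  simp only [List.nodup_append, List.nodup_cons] at hn hn'
  have := (List.append_cons_inj_of_notMem (a₁ := u) (a₂ := u) (x₁ := A) (x₂ := A') (z₁ := B)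
    (z₂ := B') (by grind) (by grind)).1 h
  grind

namespace IsCritical

variable {G : SimpleGraph V} {z y : V} {S : Set V} {p : List V} {m : ℕ}

theorem le_of_subset [Finite V] (h : IsCritical G z S y p m) {l : List V} {X : Set V}
    (hl : IsPathFrom G z l) (hy : y ∈ l) (hX : ∀ v ∈ S, v ∈ p → v ∉ l → v ∈ X) :
    m ≤ indepNumOn G (residue S y p ∪ X) := by
  refine (h.le l hl).trans (indepNumOn_mono ?_)
  rintro v ⟨hv, hvl⟩
  by_cases hvp : v ∈ p
  · exact Or.inr (hX v hv hvp hvl)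
  · exact Or.inl ⟨hv, fun hvy => hvl (hvy ▸ hy), hvp⟩

theorem le_residue_union [Finite V] (h : IsCritical G z S y p m) :
    m ≤ indepNumOn G (residue S y p ∪ {y}) := by
  refine (h.le p h.path).trans (indepNumOn_mono ?_)
  rintro v ⟨hv, hvp⟩
  by_cases hvy : v = y
  · exact Or.inr hvy
  · exact Or.inl ⟨hv, hvy, hvp⟩

theorem le_residue_add_one [Finite V] (h : IsCritical G z S y p m) :
    m ≤ indepNumOn G (residue S y p) + 1 :=
  h.le_residue_union.trans ((indepNumOn_union_le G (residue S y p) {y}).trans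
    (Nat.add_le_add_left (indepNumOn_singleton_le G y) _))

theorem le_tail [Finite V] (h : IsCritical G z S y p m) {A X M : List V} {u : V}
    (hp : p = A ++ u :: X) (hM : List.IsChain G.Adj (u :: (M ++ [y]))) (hn : M.Nodup)
    (hy : y ∉ M) (hd : ∀ v ∈ M, v ∉ p) :
    m ≤ indepNumOn G (residue S y p ∪ {v | v ∈ S ∧ v ∈ X}) := by
  have hyp := h.notMem
  obtain ⟨h1, h2, h3⟩ := h.path
  refine h.le_of_subset (l := A ++ u :: (M ++ [y])) ⟨?_, ?_, ?_⟩ (by simp) ?_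
  · rw [hp] at h1
    exact head?_append_cons_eq h1
  · rw [hp, List.isChain_split] at h2
    rw [List.isChain_split]
    exact ⟨h2.1, hM⟩
  · simp only [hp, List.nodup_append, List.nodup_cons, List.mem_append, List.mem_cons] at *
    grind
  · grind

theorem le_detour [Finite V] (h : IsCritical G z S y p m) {A X C M : List V} {u x : V}
    (hp : p = A ++ u :: (X ++ x :: C)) (hM : List.IsChain G.Adj (u :: (M ++ [x]))) (hn : M.Nodup)
    (hy : y ∈ M) (hd : ∀ v ∈ M, v ∉ p) :
    m ≤ indepNumOn G (residue S y p ∪ {v | v ∈ S ∧ v ∈ X}) := by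
  obtain ⟨h1, h2, h3⟩ := h.path
  refine h.le_of_subset (l := A ++ u :: (M ++ x :: C)) ⟨?_, ?_, ?_⟩ (by simp [hy]) ?_
  · rw [hp] at h1
    exact head?_append_cons_eq h1
  · rw [hp, List.isChain_split, isChain_cons_append_cons_iff X] at h2
    rw [List.isChain_split, isChain_cons_append_cons_iff M]
    exact ⟨h2.1, hM, h2.2.2⟩
  · simp only [hp, List.nodup_append, List.nodup_cons, List.mem_append, List.mem_cons] at *
    grind
  · grind

theorem le_crossing [Finite V] (h : IsCritical G z S y p m) {A X B X' C M Q : List V}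
    {u x u' x' : V} (hp : p = A ++ u :: (X ++ x :: (B ++ u' :: (X' ++ x' :: C))))
    (hM : List.IsChain G.Adj (u :: (M ++ [u']))) (hn : M.Nodup)
    (hy : y ∈ M) (hd : ∀ v ∈ M, v ∉ p)
    (hQ : List.IsChain G.Adj (x :: (Q ++ [x']))) (hQn : Q.Nodup) (hQd : ∀ v ∈ Q, v ∉ p)
    (hMQ : ∀ v ∈ M, v ∉ Q) :
    m ≤ indepNumOn G
      (residue S y p ∪ ({v | v ∈ S ∧ v ∈ X} ∪ {v | v ∈ S ∧ v ∈ X'})) := by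
  obtain ⟨h1, h2, h3⟩ := h.path
  refine h.le_of_subset (l := A ++ u :: (M ++ u' :: (B.reverse ++ x :: (Q ++ x' :: C))))
    ⟨?_, ?_, ?_⟩ (by simp [hy]) ?_
  · rw [hp] at h1
    exact head?_append_cons_eq h1
  · rw [hp, List.isChain_split, isChain_cons_append_cons_iff X, isChain_cons_append_cons_iff B,
      isChain_cons_append_cons_iff X'] at h2
    obtain ⟨hA, -, hB, -, hC⟩ := h2
    rw [List.isChain_split, isChain_cons_append_cons_iff M,
      isChain_cons_append_cons_iff B.reverse, isChain_cons_append_cons_iff Q]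
    refine ⟨hA, hM, ?_, hQ, hC⟩
    simpa using isChain_adj_reverse hB
  · simp only [hp, List.nodup_append, List.nodup_cons, List.mem_append, List.mem_cons,
      List.nodup_reverse, List.mem_reverse] at *
    grind
  · grind

end IsCritical

/-- The vertices `x ∈ S` after `u` on `p` such that skipping the part of `p` strictly between `u`
and `x` keeps the missed set of independence number less than `m`. -/
def detourSegment (G : SimpleGraph V) (S : Set V) (y : V) (p : List V) (m : ℕ) (u : V) : Set V :=
  {x | x ∈ S ∧ ∃ A X C, p = A ++ u :: (X ++ x :: C) ∧
    indepNumOn G (residue S y p ∪ {v | v ∈ S ∧ v ∈ X}) < m}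

namespace IsFan

variable {G : SimpleGraph V} {z y : V} {S : Set V} {p : List V} {m N : ℕ} {e : Fin N → V}
  {F : Fin N → List V}

theorem le_detourSegment [Finite V] (hF : IsFan G y p e F) (h : IsCritical G z S y p m)
    (i : Fin N) :
    m ≤ indepNumOn G (residue S y p ∪ detourSegment G S y p m (e i)) := by
  classical
  obtain ⟨A, T, hp⟩ := List.append_of_mem (hF.mem i)
  have hT := h.le_tail hp (hF.chain i) (hF.nodup i) (hF.notMem i) (hF.avoid i)
  have hex : ∃ n, m ≤ indepNumOn G (residue S y p ∪ {v | v ∈ S ∧ v ∈ T.take n}) :=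
    ⟨T.length, by simpa using hT⟩
  refine (Nat.find_spec hex).trans (indepNumOn_mono (union_subset_union_right _ ?_))
  rintro x ⟨hxS, hx⟩
  obtain ⟨n, hn, rfl⟩ := List.mem_iff_getElem.1 hx
  rw [List.length_take] at hn
  refine ⟨hxS, A, T.take n, T.drop (n + 1), ?_, ?_⟩
  · rw [List.getElem_take, List.cons_getElem_drop_succ, List.take_append_drop]
    exact hp
  · exact not_le.1 (Nat.find_min hex (by omega))

theorem mem_or_mem [Finite V] (hF : IsFan G y p e F) (h : IsCritical G z S y p m) {i j : Fin N}
    (hij : i ≠ j) {A X C : List V} {x : V} (hp : p = A ++ e i :: (X ++ x :: C))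
    (hX : indepNumOn G (residue S y p ∪ {v | v ∈ S ∧ v ∈ X}) < m) : e j ∈ A ∨ e j ∈ C := by
  by_contra hcon
  have hj := hF.mem j
  have hne : e j ≠ e i := fun h => hij (hF.inj h).symm
  have h1 : ∃ X1 C1, X ++ x :: C = X1 ++ e j :: C1 ∧ ∀ v ∈ X1, v ∈ X := by
    by_cases hjx : e j = x
    · exact ⟨X, C, by rw [hjx], fun v hv => hv⟩
    · have : e j ∈ X := by rw [hp] at hj; grind
      obtain ⟨X1, X2, rfl⟩ := List.append_of_mem this
      exact ⟨X1, X2 ++ x :: C, by simp, by grind⟩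
  obtain ⟨X1, C1, h2, h3⟩ := h1
  rw [h2] at hp
  have h4 := h.le_detour (M := F i ++ y :: (F j).reverse) hp ?_ ?_ (by simp) ?_
  · refine absurd (h4.trans (indepNumOn_mono (union_subset_union_right _ ?_))) (not_le.2 hX)
    exact fun v hv => ⟨hv.1, h3 v hv.2⟩
  · rw [List.append_assoc, List.cons_append, isChain_cons_append_cons_iff (F i)]
    refine ⟨hF.chain i, ?_⟩
    simpa using isChain_adj_reverse (hF.chain j)
  · have := hF.nodup i
    have := hF.nodup j
    have := hF.notMem i
    have := hF.notMem j
    have := hF.disj i j hij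
    simp only [List.nodup_append, List.nodup_cons, List.mem_cons, List.nodup_reverse,
      List.mem_reverse] at *
    grind
  · have := hF.avoid i
    have := hF.avoid j
    have := h.notMem
    grind

/-- In a fan whose ends are as far along `p` as possible, no path through missed vertices leads
from a segment to the fan or to `y`. -/
theorem not_reach [Finite V] [DecidableEq V] (hF : IsFan G y p e F) (h : IsCritical G z S y p m)
    (hmax : ∀ e' F', IsFan G y p (N := N) e' F' →
      ∑ i, p.idxOf (e' i) ≤ ∑ i, p.idxOf (e i))
    {i : Fin N} {A X C : List V} {x : V} (hp : p = A ++ e i :: (X ++ x :: C))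
    (hX : indepNumOn G (residue S y p ∪ {v | v ∈ S ∧ v ∈ X}) < m)
    {R : List V} {q : V} (hR : List.IsChain G.Adj (x :: (R ++ [q]))) (hRn : R.Nodup)
    (hRW : ∀ v ∈ R, v ∈ residue S y p) (hRF : ∀ j, ∀ v ∈ R, v ∉ F j)
    (hq : q = y ∨ ∃ j, q ∈ F j) : False := by
  have hyp := h.notMem
  have hRrev : List.IsChain G.Adj (q :: (R.reverse ++ [x])) := by
    simpa using isChain_adj_reverse hR
  have hRp : ∀ v ∈ R, v ≠ y ∧ v ∉ p := fun v hv => (hRW v hv).2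
  rcases hq with rfl | ⟨j, hj⟩
  · refine absurd (h.le_detour (M := F i ++ q :: R.reverse) hp ?_ ?_ (by simp) ?_) (not_le.2 hX)
    · rw [List.append_assoc, List.cons_append, isChain_cons_append_cons_iff (F i)]
      exact ⟨hF.chain i, hRrev⟩
    · have := hF.nodup i
      have := hF.notMem i
      have := hRF i
      simp only [List.nodup_append, List.nodup_cons, List.mem_cons, List.nodup_reverse,
        List.mem_reverse] at *
      grind
    · have := hF.avoid i
      grind
  · obtain ⟨F1, F2, hFj⟩ := List.append_of_mem hj
    have hnj := hF.nodup j
    have hyj := hF.notMem j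
    have hcj := hF.chain j
    have haj := hF.avoid j
    have hRj := hRF j
    rw [hFj] at hnj hyj hcj haj hRj
    rw [List.append_assoc, List.cons_append, isChain_cons_append_cons_iff F1] at hcj
    by_cases hij : i = j
    · subst hij
      have hnew : IsFan G y p (Function.update e i x) (Function.update F i (R ++ q :: F2)) := by
        have hx : x ∈ p := by simp [hp]
        have hpn := h.path.2.2
        have hxj : ∀ j, j ≠ i → e j ≠ x := by
          intro j hji hjx
          have := hF.mem_or_mem h (Ne.symm hji) hp hX
          rw [hp] at hpn
          simp only [List.nodup_append, List.nodup_cons, List.mem_append, List.mem_cons] at hpn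
          grind
        have hinj := hF.inj
        refine ⟨?_, ?_, ?_, ?_, ?_, ?_, ?_⟩
        · intro a b hab
          by_cases ha : a = i <;> by_cases hb : b = i <;>
            simp only [Function.update_apply, ha, hb, if_true, if_false] at hab ⊢
          · exact absurd hab.symm (hxj b hb)
          · exact absurd hab (hxj a ha)
          · exact hinj hab
        · intro a
          by_cases ha : a = i
          · subst ha; simpa using hx
          · simpa [ha] using hF.mem a
        · intro a
          by_cases ha : a = i
          · subst ha
            simp only [Function.update_self]
            rw [List.append_assoc, List.cons_append, isChain_cons_append_cons_iff R]
            exact ⟨hR, hcj.2⟩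
          · simpa [ha] using hF.chain a
        · intro a
          by_cases ha : a = i
          · subst ha
            simp only [Function.update_self, List.nodup_append, List.nodup_cons, List.mem_append,
              List.mem_cons] at *
            grind
          · simpa [ha] using hF.nodup a
        · intro a
          by_cases ha : a = i
          · subst ha
            simp only [Function.update_self]
            grind
          · simpa [ha] using hF.notMem a
        · intro a
          by_cases ha : a = i
          · subst ha
            simp only [Function.update_self]
            grind
          · simpa [ha] using hF.avoid a
        · have hd := hF.disj
          intro a b hab
          by_cases ha : a = i <;> by_cases hb : b = i <;>
            simp only [Function.update_apply, ha, hb, if_true, if_false]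
          · exact absurd (ha.trans hb.symm) hab
          · have := hd i b (Ne.symm hb)
            have := hRF b
            grind
          · have := hd a i ha
            have := hRF a
            grind
          · exact hd a b hab
      refine absurd (hmax _ _ hnew) (not_le.2 (Finset.sum_lt_sum (fun a _ => ?_)
        ⟨i, Finset.mem_univ i, ?_⟩))
      all_goals
        have hlt : p.idxOf (e i) < p.idxOf x := by
          have hpn := h.path.2.2
          rw [hp] at hpn ⊢
          simp only [List.nodup_append, List.nodup_cons, List.mem_append, List.mem_cons] at hpn
          rw [List.idxOf_append_of_notMem (by grind), List.idxOf_append_of_notMem (by grind),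
            List.idxOf_cons_self, List.idxOf_cons_ne _ (by grind)]
          omega
      · by_cases ha : a = i
        · subst ha; simpa using hlt.le
        · simp [ha]
      · simpa using hlt
    · refine absurd (h.le_detour (M := F i ++ y :: (F2.reverse ++ q :: R.reverse)) hp ?_ ?_
        (by simp) ?_) (not_le.2 hX)
      · rw [List.append_assoc, List.cons_append, isChain_cons_append_cons_iff (F i),
          List.append_assoc, List.cons_append, isChain_cons_append_cons_iff F2.reverse]
        exact ⟨hF.chain i, by simpa using isChain_adj_reverse hcj.2, hRrev⟩
      · have := hF.nodup i
        have := hF.notMem i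
        have := hRF i
        have := hF.disj i j hij
        rw [hFj] at this
        simp only [List.nodup_append, List.nodup_cons, List.mem_append, List.mem_cons,
          List.nodup_reverse, List.mem_reverse] at *
        grind
      · have := hF.avoid i
        grind

end IsFan

theorem List.exists_first_of_exists {P : V → Prop} {l : List V} (h : ∃ v ∈ l, P v) :
    ∃ R q T, l = R ++ q :: T ∧ P q ∧ ∀ v ∈ R, ¬ P v := by
  induction l with
  | nil => simp at h
  | cons a l ih =>
    by_cases ha : P a
    · exact ⟨[], a, l, rfl, ha, by simp⟩
    · obtain ⟨R, q, T, rfl, hq, hR⟩ := ih (by grind)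
      exact ⟨a :: R, q, T, rfl, hq, by grind⟩

namespace IsFan

variable {G : SimpleGraph V} {z y : V} {S : Set V} {p : List V} {m N : ℕ} {e : Fin N → V}
  {F : Fin N → List V}

/-- Of two fan ends with given points of their segments, one comes after the other's point. -/
theorem mem_suffix_or_mem_suffix [Finite V] (hF : IsFan G y p e F) (h : IsCritical G z S y p m)
    {i j : Fin N} (hij : i ≠ j) {A X C A' X' C' : List V} {x x' : V}
    (hp : p = A ++ e i :: (X ++ x :: C))
    (hX : indepNumOn G (residue S y p ∪ {v | v ∈ S ∧ v ∈ X}) < m)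
    (hp' : p = A' ++ e j :: (X' ++ x' :: C'))
    (hX' : indepNumOn G (residue S y p ∪ {v | v ∈ S ∧ v ∈ X'}) < m) : e j ∈ C ∨ e i ∈ C' := by
  rcases hF.mem_or_mem h hij hp hX with hj | hj
  · rcases hF.mem_or_mem h hij.symm hp' hX' with hi | hi
    · obtain ⟨A1, A2, rfl⟩ := List.append_of_mem hj
      have hpn := h.path.2.2
      have h1 : p = A1 ++ e j :: (A2 ++ e i :: (X ++ x :: C)) := by simp [hp]
      rw [h1] at hpn
      obtain ⟨rfl, -⟩ := hpn.append_cons_inj (h1.symm.trans hp')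
      simp only [List.nodup_append, List.nodup_cons, List.mem_append, List.mem_cons] at hpn
      grind
    · exact Or.inr hi
  · exact Or.inl hj

theorem link_avoid [Finite V] [DecidableEq V] (hF : IsFan G y p e F)
    (h : IsCritical G z S y p m)
    (hmax : ∀ e' F', IsFan G y p (N := N) e' F' →
      ∑ i, p.idxOf (e' i) ≤ ∑ i, p.idxOf (e i))
    {i : Fin N} {A X C : List V} {x w : V} (hp : p = A ++ e i :: (X ++ x :: C))
    (hX : indepNumOn G (residue S y p ∪ {v | v ∈ S ∧ v ∈ X}) < m)
    {Q : List V} (hQ : List.IsChain G.Adj (x :: (Q ++ [w]))) (hQn : Q.Nodup)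
    (hQW : ∀ v ∈ Q, v ∈ residue S y p) (j : Fin N) : ∀ v ∈ Q, v ∉ F j := by
  intro v hv hvj
  obtain ⟨R, q, T, rfl, hq, hR⟩ :=
    List.exists_first_of_exists (P := fun v => ∃ j, v ∈ F j) ⟨v, hv, j, hvj⟩
  rw [List.append_assoc, List.cons_append, isChain_cons_append_cons_iff R] at hQ
  exact hF.not_reach h hmax hp hX hQ.1 hQn.of_append_left
    (fun v hv => hQW v (by simp [hv])) (fun j v hv hj => hR v hv ⟨j, hj⟩) (Or.inr hq)

theorem not_link [Finite V] [DecidableEq V] (hF : IsFan G y p e F)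
    (h : IsCritical G z S y p m)
    (hmax : ∀ e' F', IsFan G y p (N := N) e' F' →
      ∑ i, p.idxOf (e' i) ≤ ∑ i, p.idxOf (e i)) (n : ℕ) :
    ∀ {i j : Fin N}, i ≠ j → ∀ {A X C A' X' C' Q : List V} {x x' : V},
    X.length + X'.length = n → p = A ++ e i :: (X ++ x :: C) →
    indepNumOn G (residue S y p ∪ {v | v ∈ S ∧ v ∈ X}) < m →
    p = A' ++ e j :: (X' ++ x' :: C') →
    indepNumOn G (residue S y p ∪ {v | v ∈ S ∧ v ∈ X'}) < m →
    List.IsChain G.Adj (x :: (Q ++ [x'])) → Q.Nodup → (∀ v ∈ Q, v ∈ residue S y p) → False := by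
  induction n using Nat.strong_induction_on with
  | _ n ih =>
  have main : ∀ {i j : Fin N}, i ≠ j → ∀ {A X C A' X' C' Q : List V} {x x' : V},
      X.length + X'.length = n → p = A ++ e i :: (X ++ x :: C) →
      indepNumOn G (residue S y p ∪ {v | v ∈ S ∧ v ∈ X}) < m →
      p = A' ++ e j :: (X' ++ x' :: C') →
      indepNumOn G (residue S y p ∪ {v | v ∈ S ∧ v ∈ X'}) < m →
      List.IsChain G.Adj (x :: (Q ++ [x'])) → Q.Nodup → (∀ v ∈ Q, v ∈ residue S y p) →
      e j ∈ C → False := by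
    intro i j hij A X C A' X' C' Q x x' hn hp hX hp' hX' hQ hQn hQW hC
    obtain ⟨B, T, rfl⟩ := List.append_of_mem hC
    have hpn := h.path.2.2
    have hT : T = X' ++ x' :: C' := by
      have h1 : p = (A ++ e i :: (X ++ x :: B)) ++ e j :: T := by simp [hp]
      rw [h1] at hpn
      exact (hpn.append_cons_inj (h1.symm.trans hp')).2
    subst hT
    have hdisj : Disjoint {v | v ∈ S ∧ v ∈ X} {v | v ∈ S ∧ v ∈ X'} := by
      rw [Set.disjoint_left]
      rw [hp] at hpn
      simp only [List.nodup_append, List.nodup_cons, List.mem_append, List.mem_cons] at hpn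
      rintro v ⟨-, hv⟩ ⟨-, hv'⟩
      grind
    have hW1 : Disjoint (residue S y p) {v | v ∈ S ∧ v ∈ X} := by
      rw [Set.disjoint_left]
      rintro v ⟨-, -, hv⟩ ⟨-, hv'⟩
      exact hv (by simp [hp, hv'])
    have hW2 : Disjoint (residue S y p) {v | v ∈ S ∧ v ∈ X'} := by
      rw [Set.disjoint_left]
      rintro v ⟨-, -, hv⟩ ⟨-, hv'⟩
      exact hv (by simp [hp, hv'])
    rcases exists_link_or_modular G hdisj hW1 hW2 with
      ⟨a, ⟨-, ha⟩, b, ⟨-, hb⟩, Q', hQW', hQn', hQ'⟩ | hmod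
    · obtain ⟨X1, X2, rfl⟩ := List.append_of_mem ha
      obtain ⟨X1', X2', rfl⟩ := List.append_of_mem hb
      refine ih (X1.length + X1'.length) ?_ hij rfl
        (A := A) (C := X2 ++ x :: (B ++ e j :: ((X1' ++ b :: X2') ++ x' :: C'))) ?_ ?_
        (A' := A') (C' := X2' ++ x' :: C') ?_ ?_ hQ' hQn' hQW'
      · simp only [List.length_append, List.length_cons] at hn
        omega
      · simp [hp]
      · refine lt_of_le_of_lt (indepNumOn_mono (union_subset_union_right _ ?_)) hX
        exact fun v hv => ⟨hv.1, List.mem_append_left _ hv.2⟩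
      · simp [hp']
      · refine lt_of_le_of_lt (indepNumOn_mono (union_subset_union_right _ ?_)) hX'
        exact fun v hv => ⟨hv.1, List.mem_append_left _ hv.2⟩
    · have hQF := hF.link_avoid h hmax hp hX hQ hQn hQW
      have hcross := h.le_crossing (M := F i ++ y :: (F j).reverse) hp ?_ ?_ (by simp) ?_ hQ hQn
        (fun v hv => (hQW v hv).2.2) ?_
      · have hW := h.le_residue_add_one
        omega
      · rw [List.append_assoc, List.cons_append, isChain_cons_append_cons_iff (F i)]
        exact ⟨hF.chain i, by simpa using isChain_adj_reverse (hF.chain j)⟩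
      · have := hF.nodup i
        have := hF.nodup j
        have := hF.notMem i
        have := hF.notMem j
        have := hF.disj i j hij
        simp only [List.nodup_append, List.nodup_cons, List.mem_cons, List.nodup_reverse,
          List.mem_reverse] at *
        grind
      · have := hF.avoid i
        have := hF.avoid j
        have := h.notMem
        grind
      · have := hQF i
        have := hQF j
        have : ∀ v ∈ Q, v ≠ y := fun v hv => (hQW v hv).2.1
        grind
  intro i j hij A X C A' X' C' Q x x' hn hp hX hp' hX' hQ hQn hQW
  rcases hF.mem_suffix_or_mem_suffix h hij hp hX hp' hX' with hj | hi
  · exact main hij hn hp hX hp' hX' hQ hQn hQW hj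
  · exact main hij.symm (by omega) hp' hX' hp hX (Q := Q.reverse)
      (by simpa using isChain_adj_reverse hQ) (List.nodup_reverse.2 hQn)
      (by simpa using hQW) hi

theorem disjoint_detourSegment [Finite V] (hF : IsFan G y p e F) (h : IsCritical G z S y p m)
    {i j : Fin N} (hij : i ≠ j) :
    Disjoint (detourSegment G S y p m (e i)) (detourSegment G S y p m (e j)) := by
  have main : ∀ {i j : Fin N}, i ≠ j → ∀ {A X C A' X' C' : List V} {x : V},
      p = A ++ e i :: (X ++ x :: C) → p = A' ++ e j :: (X' ++ x :: C') → e j ∈ C → False := by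
    intro i j hij A X C A' X' C' x hp hp' hC
    obtain ⟨B, T, rfl⟩ := List.append_of_mem hC
    have hpn := h.path.2.2
    have h1 : p = (A ++ e i :: (X ++ x :: B)) ++ e j :: T := by simp [hp]
    rw [h1] at hpn
    obtain ⟨-, rfl⟩ := hpn.append_cons_inj (h1.symm.trans hp')
    simp only [List.nodup_append, List.nodup_cons, List.mem_append, List.mem_cons] at hpn
    grind
  rw [Set.disjoint_left]
  rintro x ⟨-, A, X, C, hp, hX⟩ ⟨-, A', X', C', hp', hX'⟩
  rcases hF.mem_suffix_or_mem_suffix h hij hp hX hp' hX' with hj | hi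
  · exact main hij hp hp' hj
  · exact main hij.symm hp' hp hi

end IsFan

namespace IsFan

variable {G : SimpleGraph V} {z y : V} {S : Set V} {p : List V} {m N : ℕ} {e : Fin N → V}
  {F : Fin N → List V}

theorem add_le_indepNumOn [Finite V] [DecidableEq V] (hF : IsFan G y p e F)
    (h : IsCritical G z S y p m)
    (hmax : ∀ e' F', IsFan G y p (N := N) e' F' →
      ∑ i, p.idxOf (e' i) ≤ ∑ i, p.idxOf (e i)) : m + N ≤ indepNumOn G S := by
  have hseg : ∀ i, ∀ v ∈ detourSegment G S y p m (e i), v ∈ p := by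
    rintro i v ⟨-, A, X, C, hp, -⟩
    simp [hp]
  have key : ∀ J : Finset (Fin N), m + J.card ≤ indepNumOn G
      (residue S y p ∪ ({y} ∪ ⋃ i ∈ J, detourSegment G S y p m (e i))) := by
    intro J
    induction J using Finset.induction_on with
    | empty => simpa using h.le_residue_union
    | insert i J hi ih =>
      have hi' : ∀ j ∈ J, i ≠ j := fun j hj hij => hi (hij ▸ hj)
      have hd : Disjoint (detourSegment G S y p m (e i))
          ({y} ∪ ⋃ i ∈ J, detourSegment G S y p m (e i)) := by
        rw [disjoint_union_right, disjoint_singleton_right, disjoint_iUnion₂_right]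
        exact ⟨fun hy => h.notMem (hseg i y hy),
          fun j hj => hF.disjoint_detourSegment h (hi' j hj)⟩
      have hdW : ∀ j, Disjoint (residue S y p) (detourSegment G S y p m (e j)) := by
        intro j
        rw [Set.disjoint_left]
        exact fun v hv hv' => hv.2.2 (hseg j v hv')
      have hdW' : Disjoint (residue S y p)
          ({y} ∪ ⋃ i ∈ J, detourSegment G S y p m (e i)) := by
        rw [disjoint_union_right, disjoint_singleton_right, disjoint_iUnion₂_right]
        exact ⟨fun hy => hy.2.1 rfl, fun j _ => hdW j⟩
      rcases exists_link_or_modular G hd (hdW i) hdW' with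
        ⟨x, ⟨-, A, X, C, hp, hX⟩, b, hb, Q, hQW, hQn, hQ⟩ | hmod
      · exfalso
        rcases hb with rfl | hb
        · exact hF.not_reach h hmax hp hX hQ hQn hQW
            (hF.link_avoid h hmax hp hX hQ hQn hQW) (Or.inl rfl)
        · simp only [mem_iUnion] at hb
          obtain ⟨j, hj, -, A', X', C', hp', hX'⟩ := hb
          exact hF.not_link h hmax _ (hi' j hj) rfl hp hX hp' hX' hQ hQn hQW
      · have h1 := hF.le_detourSegment h i
        have h2 := h.lt
        rw [Finset.card_insert_of_notMem hi, Finset.set_biUnion_insert, union_left_comm {y}]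
        omega
  have h1 := key Finset.univ
  rw [Finset.card_univ, Fintype.card_fin] at h1
  refine h1.trans (indepNumOn_mono (union_subset (fun v hv => hv.1) (union_subset ?_ ?_)))
  · simpa using h.mem
  · simp only [iUnion_subset_iff]
    exact fun i _ v hv => hv.1

end IsFan

/-- The lists `L i` are the interiors of pairwise internally disjoint `y`–`b` paths. -/
structure IsDisjointPaths (G : SimpleGraph V) (y b : V) {N : ℕ} (L : Fin N → List V) : Prop where
  chain : ∀ i, List.IsChain G.Adj (y :: (L i ++ [b]))
  nodup : ∀ i, (L i).Nodup
  left_notMem : ∀ i, y ∉ L i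
  right_notMem : ∀ i, b ∉ L i
  disj : ∀ i j, i ≠ j → ∀ v ∈ L i, v ∉ L j

theorem IsDisjointPaths.exists_isFan [Finite V] {G : SimpleGraph V} {z y b : V} {S : Set V}
    {q : List V} {m N : ℕ} {L : Fin N → List V} (hL : IsDisjointPaths G y b L)
    (h : IsCritical G z S y (q ++ [b]) m) :
    ∃ (e : Fin N → V) (F : Fin N → List V), IsFan G y (q ++ [b]) e F := by
  have hyp := h.notMem
  have hfirst : ∀ i, ∃ R u T, L i ++ [b] = R ++ u :: T ∧ u ∈ q ++ [b] ∧ ∀ v ∈ R, v ∉ q ++ [b] :=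
    fun i => List.exists_first_of_exists ⟨b, by simp, by simp⟩
  choose R u T hRT hu hR using hfirst
  have hnd : ∀ i, (R i ++ u i :: T i).Nodup := by
    intro i
    rw [← hRT]
    have := hL.nodup i
    have := hL.right_notMem i
    simp only [List.nodup_append, List.nodup_cons]
    grind
  have hch : ∀ i, List.IsChain G.Adj (u i :: ((R i).reverse ++ [y])) := by
    intro i
    have := hL.chain i
    rw [hRT, isChain_cons_append_cons_iff] at this
    simpa using isChain_adj_reverse this.1
  have hyR : ∀ i, y ∉ R i := by
    intro i hy
    have : y ∈ L i ++ [b] := by rw [hRT]; simp [hy]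
    have := hL.left_notMem i
    grind
  have hub : ∀ i, u i ≠ b := by
    intro i hi
    have hci := hch i
    rw [hi] at hci
    refine absurd (h.le_tail (X := []) rfl hci ?_ ?_ ?_) (not_le.2 ?_)
    · exact List.nodup_reverse.2 (hnd i).of_append_left
    · simpa using hyR i
    · simpa using hR i
    · simpa using h.lt
  have hsub : ∀ i, ∀ v ∈ R i ++ [u i], v ∈ L i := by
    intro i v hv
    have h1 : v ∈ L i ++ [b] := by rw [hRT]; grind
    have h2 := hR i v
    have h3 := hub i
    grind
  refine ⟨u, fun i => (R i).reverse, ?_, hu, hch, ?_, ?_, ?_, ?_⟩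
  · intro i j hij
    by_contra hne
    exact hL.disj i j hne (u i) (hsub i _ (by simp)) (hsub j _ (by simp [hij]))
  · exact fun i => List.nodup_reverse.2 (hnd i).of_append_left
  · simpa using hyR
  · simpa using hR
  · intro i j hij v hv hv'
    exact hL.disj i j hij v (hsub i _ (by simp_all)) (hsub j _ (by simp_all))

/-- If `z` is adjacent to all other vertices and any two vertices of `S` are joined by `N`
internally disjoint paths, then some path from `z` lowers the independence number of `S` to a value
less than `m`, unless `S` has an independent subset of size `m + N`. -/
theorem add_le_indepNumOn_of_forall_path [Finite V] {G : SimpleGraph V} {z : V} {m N : ℕ}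
    (hz : ∀ v, v ≠ z → G.Adj z v) (hm : 1 ≤ m) (S : Set V) (hzS : z ∉ S)
    (hS : ∀ y ∈ S, ∀ b ∈ S, y ≠ b → ∃ L : Fin N → List V, IsDisjointPaths G y b L)
    (hbad : ∀ l, IsPathFrom G z l → m ≤ indepNumOn G {v | v ∈ S ∧ v ∉ l}) :
    m + N ≤ indepNumOn G S := by
  classical
  induction hn : S.ncard using Nat.strong_induction_on generalizing S with
  | _ n ih =>
  have hzp : IsPathFrom G z [z] := ⟨rfl, by simp, by simp⟩
  have hne : S.Nonempty := by
    by_contra hS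
    have h1 := hbad _ hzp
    obtain ⟨I, hI, -, hc⟩ := exists_maxIndepOn G {v | v ∈ S ∧ v ∉ [z]}
    rw [not_nonempty_iff_eq_empty] at hS
    have : I = ∅ := by
      rw [← subset_empty_iff, ← hS]
      exact hI.trans fun v hv => hv.1
    rw [this, ncard_empty] at hc
    omega
  obtain ⟨y, hy⟩ := hne
  by_cases hbad' : ∀ l, IsPathFrom G z l → m ≤ indepNumOn G {v | v ∈ S \ {y} ∧ v ∉ l}
  · refine (ih (S \ {y}).ncard ?_ (S \ {y}) (fun h => hzS h.1)
      (fun a ha b hb => hS a ha.1 b hb.1) hbad' rfl).trans (indepNumOn_mono sdiff_subset)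
    rw [← hn]
    exact Set.ncard_sdiff_singleton_lt_of_mem hy
  push Not at hbad'
  have hex : ∃ n, ∃ l, l.length = n ∧ IsPathFrom G z l ∧
      indepNumOn G {v | v ∈ S \ {y} ∧ v ∉ l} < m := by
    obtain ⟨l, hl⟩ := hbad'
    exact ⟨_, l, rfl, hl⟩
  obtain ⟨l, hlen, hl, hlt⟩ := Nat.find_spec hex
  have hres : {v | v ∈ S \ {y} ∧ v ∉ l} = residue S y l := by
    ext v
    simp [residue, and_assoc]
  have hcover : ∀ l', IsPathFrom G z l' → y ∈ l' → ∃ v ∈ l, v ∈ S ∧ v ∉ l' := by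
    intro l' hl' hy'
    by_contra hcon
    push Not at hcon
    refine absurd (hbad l' hl') (not_le.2 (lt_of_le_of_lt (indepNumOn_mono ?_) hlt))
    rintro v ⟨hv, hv'⟩
    exact ⟨⟨hv, fun hvy => hv' ((mem_singleton_iff.1 hvy).symm ▸ hy')⟩,
      fun hvl => hv' (hcon v hvl hv)⟩
  have hyl : y ∉ l := by
    intro hyl
    obtain ⟨v, hv, -, hv'⟩ := hcover l hl hyl
    exact hv' hv
  have hcrit : IsCritical G z S y l m := ⟨hl, hyl, hy, hres ▸ hlt, hbad⟩
  have hlne : l ≠ [] := by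
    rintro rfl
    simpa using hl.1
  obtain ⟨q, b, rfl⟩ : ∃ q b, l = q ++ [b] :=
    ⟨l.dropLast, l.getLast hlne, (List.dropLast_append_getLast hlne).symm⟩
  have hqne : q ≠ [] := by
    rintro rfl
    have hbz : b = z := by simpa using hl.1
    have hyz : y ≠ z := fun h => hzS (h ▸ hy)
    obtain ⟨v, hv, hvS, -⟩ := hcover [z, y]
      ⟨rfl, by simpa using hz y hyz, by simpa using hyz.symm⟩ (by simp)
    have : v = z := by simpa [hbz] using hv
    exact hzS (this ▸ hvS)
  have hbS : b ∈ S := by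
    by_contra hbS
    refine Nat.find_min hex (m := q.length) (by rw [← hlen]; simp) ⟨q, rfl, ⟨?_, ?_, ?_⟩, ?_⟩
    · obtain ⟨a, q, rfl⟩ := List.exists_cons_of_ne_nil hqne
      simpa using hl.1
    · exact (List.isChain_append.1 hl.2.1).1
    · exact hl.2.2.of_append_left
    · refine lt_of_le_of_lt (indepNumOn_mono ?_) hlt
      rintro v ⟨hv, hvq⟩
      refine ⟨hv, ?_⟩
      simp only [List.mem_append, List.mem_singleton, not_or]
      exact ⟨hvq, fun h => hbS (h ▸ hv.1)⟩
  obtain ⟨L, hL⟩ := hS y hy b hbS (by rintro rfl; exact hyl (by simp))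
  obtain ⟨e₀, F₀, hF₀⟩ := hL.exists_isFan hcrit
  let M : Set ℕ := {s | ∃ e F, IsFan G y (q ++ [b]) (N := N) e F ∧
    ∑ i, (q ++ [b]).idxOf (e i) = s}
  have hMb : BddAbove M := by
    refine ⟨∑ _i : Fin N, (q ++ [b]).length, ?_⟩
    rintro s ⟨e, F, -, rfl⟩
    exact Finset.sum_le_sum fun i _ => List.idxOf_le_length
  obtain ⟨e, F, hF, hs⟩ : sSup M ∈ M := Nat.sSup_mem ⟨_, e₀, F₀, hF₀, rfl⟩ hMb
  exact hF.add_le_indepNumOn hcrit fun e' F' hF' => hs ▸ le_csSup hMb ⟨e', F', hF', rfl⟩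

/-- A connected subgraph with one vertex more than it has edges. -/
structure IsSubtree {G : SimpleGraph V} (T : G.Subgraph) : Prop where
  connected : T.Connected
  card : T.edgeSet.ncard + 1 = T.verts.ncard

theorem IsSubtree.isTree [Finite V] {G : SimpleGraph V} {T : G.Subgraph} (hT : IsSubtree T) :
    T.coe.IsTree := by
  rw [isTree_iff_connected_and_card]
  refine ⟨hT.connected.coe, ?_⟩
  rw [Nat.card_coe_set_eq, Nat.card_coe_set_eq, ← hT.card, ← Subgraph.image_coe_edgeSet_coe,
    Set.ncard_image_of_injective _ (Sym2.map.injective Subtype.val_injective)]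

theorem isSubtree_singletonSubgraph (G : SimpleGraph V) (v : V) :
    IsSubtree (G.singletonSubgraph v) :=
  ⟨Subgraph.singletonSubgraph_connected, by simp⟩

theorem IsSubtree.exists_insert [Finite V] {G : SimpleGraph V} {T : G.Subgraph}
    (hT : IsSubtree T) {u v : V} (hu : u ∈ T.verts) (hv : v ∉ T.verts) (h : G.Adj u v) :
    ∃ T' : G.Subgraph, IsSubtree T' ∧ T'.verts = insert v T.verts ∧
      (T'.neighborSet v).ncard ≤ 1 ∧ subBranches T' ⊆ insert u (subBranches T) ∧
      ((T.neighborSet u).ncard ≤ 1 → subBranches T' ⊆ subBranches T) := by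
  have huv : u ≠ v := h.ne
  have hadj : ∀ a b, T.Adj a b → a ≠ v ∧ b ≠ v := fun a b hab =>
    ⟨fun h => hv (h ▸ T.edge_vert hab), fun h => hv (h ▸ T.edge_vert hab.symm)⟩
  have hverts : (T ⊔ G.subgraphOfAdj h).verts = insert v T.verts := by
    ext w
    simp only [Subgraph.verts_sup, subgraphOfAdj_verts, mem_union, mem_insert_iff,
      mem_singleton_iff]
    grind
  have hnbr : ∀ a b, (T ⊔ G.subgraphOfAdj h).Adj a b ↔
      T.Adj a b ∨ (a = u ∧ b = v) ∨ (a = v ∧ b = u) := by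
    intro a b
    simp only [Subgraph.sup_adj, subgraphOfAdj_adj, Sym2.eq_iff]
    grind
  have hnv : (T ⊔ G.subgraphOfAdj h).neighborSet v ⊆ {u} := by
    intro b hb
    rw [Subgraph.mem_neighborSet, hnbr] at hb
    have := hadj v b
    simp only [mem_singleton_iff]
    grind
  have hnu : (T ⊔ G.subgraphOfAdj h).neighborSet u ⊆ insert v (T.neighborSet u) := by
    intro b hb
    rw [Subgraph.mem_neighborSet, hnbr] at hb
    simp only [mem_insert_iff, Subgraph.mem_neighborSet]
    grind
  have hnw : ∀ w, w ≠ u → w ≠ v →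
      (T ⊔ G.subgraphOfAdj h).neighborSet w = T.neighborSet w := by
    intro w h1 h2
    ext b
    rw [Subgraph.mem_neighborSet, hnbr, Subgraph.mem_neighborSet]
    grind
  have hv1 : ((T ⊔ G.subgraphOfAdj h).neighborSet v).ncard ≤ 1 :=
    (Set.ncard_le_ncard hnv).trans (by simp)
  have hbr : subBranches (T ⊔ G.subgraphOfAdj h) ⊆ insert u (subBranches T) := by
    rintro w ⟨hw, hd⟩
    by_cases h1 : w = u
    · exact Or.inl h1
    · have h2 : w ≠ v := by rintro rfl; omega
      rw [hnw w h1 h2] at hd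
      rw [hverts] at hw
      exact Or.inr ⟨hw.resolve_left h2, hd⟩
  refine ⟨T ⊔ G.subgraphOfAdj h, ⟨?_, ?_⟩, hverts, hv1, hbr, fun hd => ?_⟩
  · exact Subgraph.connected_sup hT.connected.preconnected
      (Subgraph.subgraphOfAdj_connected h).preconnected ⟨u, hu, by simp⟩
  · have he : (T ⊔ G.subgraphOfAdj h).edgeSet = insert s(u, v) T.edgeSet := by
      rw [Subgraph.edgeSet_sup, edgeSet_subgraphOfAdj, union_singleton]
    have hnot : s(u, v) ∉ T.edgeSet := fun h' => (hadj u v h').2 rfl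
    rw [he, hverts, Set.ncard_insert_of_notMem hnot, Set.ncard_insert_of_notMem hv, hT.card]
  · intro w hw
    rcases hbr hw with rfl | h'
    · have h1 := hw.2
      have h2 := Set.ncard_le_ncard hnu
      have h3 := Set.ncard_insert_le v (T.neighborSet w)
      omega
    · exact h'

theorem exists_isSubtree_of_path [Finite V] {G : SimpleGraph V} (v : V) (l : List V)
    (hc : (v :: l).IsChain G.Adj) (hn : (v :: l).Nodup) :
    ∃ T : G.Subgraph, IsSubtree T ∧ T.verts = {w | w ∈ v :: l} ∧
      (T.neighborSet v).ncard ≤ 1 ∧ subBranches T = ∅ := by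
  induction l generalizing v with
  | nil =>
    have hz : ∀ w, ((G.singletonSubgraph v).neighborSet w).ncard = 0 := by
      intro w
      rw [Set.ncard_eq_zero, eq_empty_iff_forall_notMem]
      intro b hb
      simp at hb
    refine ⟨_, isSubtree_singletonSubgraph G v, by simp, by rw [hz]; omega, ?_⟩
    rw [eq_empty_iff_forall_notMem]
    rintro w ⟨-, hw⟩
    rw [hz] at hw
    omega
  | cons a l ih =>
    rw [List.isChain_cons_cons] at hc
    rw [List.nodup_cons] at hn
    obtain ⟨T, hT, hverts, hd, hb⟩ := ih a hc.2 hn.2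
    obtain ⟨T', hT', hverts', hd', -, hb'⟩ :=
      hT.exists_insert (u := a) (v := v) (by simp [hverts]) (by simpa [hverts] using hn.1) hc.1.symm
    refine ⟨T', hT', ?_, hd', subset_empty_iff.1 (hb ▸ hb' hd)⟩
    rw [hverts', hverts]
    ext w
    simp

theorem IsSubtree.exists_attach [Finite V] {G : SimpleGraph V} {T : G.Subgraph}
    (hT : IsSubtree T) {y u : V} (w : G.Walk y u) (hw : w.IsPath) (hu : u ∈ T.verts)
    (hy : y ∉ T.verts) :
    ∃ T' : G.Subgraph, IsSubtree T' ∧ T.verts ⊆ T'.verts ∧ y ∈ T'.verts ∧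
      (∀ v ∈ T'.verts, v ∈ T.verts ∨ v ∈ w.support) ∧
      (T'.neighborSet y).ncard ≤ 1 ∧ (subBranches T').ncard ≤ (subBranches T).ncard + 1 := by
  induction w with
  | nil => exact absurd hu hy
  | @cons y a u h w ih =>
    rw [Walk.cons_isPath_iff] at hw
    by_cases ha : a ∈ T.verts
    · obtain ⟨T', hT', hverts, hd, hb, -⟩ := hT.exists_insert ha hy h.symm
      refine ⟨T', hT', by simp [hverts], by simp [hverts], ?_, hd,
        (Set.ncard_le_ncard hb).trans (Set.ncard_insert_le _ _)⟩
      intro v hv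
      rw [hverts] at hv
      rcases hv with rfl | hv
      · simp
      · exact Or.inl hv
    · obtain ⟨T₁, hT₁, hsub, ha₁, hsup, hd₁, hb₁⟩ := ih hw.1 hu ha
      have hy₁ : y ∉ T₁.verts := fun h' => (hsup y h').elim hy hw.2
      obtain ⟨T', hT', hverts, hd, -, hb⟩ := hT₁.exists_insert ha₁ hy₁ h.symm
      refine ⟨T', hT', hsub.trans (by simp [hverts]), by simp [hverts], ?_, hd,
        (Set.ncard_le_ncard (hb hd₁)).trans hb₁⟩
      intro v hv
      rw [hverts] at hv
      rcases hv with rfl | hv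
      · simp
      · exact (hsup v hv).imp_right fun h => by simp [h]

/-- A tree that misses a set of independence number at most `n` in `S` extends to one covering
`S` with at most `n` more branch vertices. -/
theorem IsSubtree.exists_cover [Finite V] {G : SimpleGraph V} (hG : G.Connected) (S : Set V)
    (n : ℕ) (T : G.Subgraph) (hT : IsSubtree T) (hn : indepNumOn G (S \ T.verts) ≤ n) :
    ∃ T' : G.Subgraph, IsSubtree T' ∧ S ⊆ T'.verts ∧
      (subBranches T').ncard ≤ (subBranches T).ncard + n := by
  classical
  induction n generalizing T with
  | zero =>
    refine ⟨T, hT, fun v hv => ?_, le_rfl⟩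
    by_contra hvT
    have := (indep_ncard_le (G := G) (A := S \ T.verts) (I := {v})
      (singleton_subset_iff.2 ⟨hv, hvT⟩) (by simp)).trans hn
    simp at this
  | succ n ih =>
    by_cases hS : S ⊆ T.verts
    · exact ⟨T, hT, hS, by omega⟩
    obtain ⟨y, hyS, hyT⟩ := Set.not_subset.1 hS
    let P : Set ℕ := {s | ∃ (T' : G.Subgraph) (v : V), T'.verts.ncard = s ∧ IsSubtree T' ∧
      T.verts ⊆ T'.verts ∧ v ∈ S ∧ v ∉ T.verts ∧ v ∈ T'.verts ∧ (T'.neighborSet v).ncard ≤ 1 ∧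
      (subBranches T').ncard ≤ (subBranches T).ncard + 1}
    have hPb : BddAbove P := by
      refine ⟨Nat.card V, ?_⟩
      rintro s ⟨T', v, rfl, -⟩
      exact Set.ncard_le_card _
    have hPne : P.Nonempty := by
      obtain ⟨u, hu⟩ := hT.connected.nonempty
      obtain ⟨w⟩ := hG.preconnected y u
      obtain ⟨T', hT', hsub, hy, -, hd, hb⟩ := hT.exists_attach w.bypass w.bypass_isPath hu hyT
      exact ⟨_, T', y, rfl, hT', hsub, hyS, hyT, hy, hd, hb⟩
    obtain ⟨T', v, hs, hT', hsub, hvS, hvT, hvT', hd, hb⟩ : sSup P ∈ P := Nat.sSup_mem hPne hPb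
    have hstuck : ∀ a ∈ S \ T'.verts, ¬ G.Adj v a := by
      rintro a ⟨haS, haT'⟩ hva
      obtain ⟨T₂, hT₂, hverts, hd₂, -, hb₂⟩ := hT'.exists_insert hvT' haT' hva
      have hmem : T₂.verts.ncard ∈ P :=
        ⟨T₂, a, rfl, hT₂, hsub.trans (by simp [hverts]), haS, fun h => haT' (hsub h),
          by simp [hverts], hd₂, (Set.ncard_le_ncard (hb₂ hd)).trans hb⟩
      have := le_csSup hPb hmem
      rw [hverts, Set.ncard_insert_of_notMem haT', hs] at this
      omega
    have hlt : indepNumOn G (S \ T'.verts) ≤ n := by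
      obtain ⟨I, hI, hp, hc⟩ := exists_maxIndepOn G (S \ T'.verts)
      have h1 : insert v I ⊆ S \ T.verts := by
        rw [insert_subset_iff]
        exact ⟨⟨hvS, hvT⟩, fun a ha => ⟨(hI ha).1, fun h => (hI ha).2 (hsub h)⟩⟩
      have h2 : (insert v I).Pairwise fun a b => ¬ G.Adj a b := by
        rw [Set.pairwise_insert]
        exact ⟨hp, fun b hb _ =>
          ⟨hstuck b (hI hb), fun h => hstuck b (hI hb) h.symm⟩⟩
      have h3 := (indep_ncard_le h1 h2).trans hn
      rw [Set.ncard_insert_of_notMem fun h => (hI h).2 hvT'] at h3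
      omega
    obtain ⟨T₂, hT₂, hS₂, hb₂⟩ := ih T' hT' hlt
    exact ⟨T₂, hT₂, hS₂, by omega⟩

/-- The graph `G` with a new vertex `none` joined to all vertices. -/
def cone (G : SimpleGraph V) : SimpleGraph (Option V) where
  Adj a b := a ≠ b ∧ ∀ x ∈ a, ∀ y ∈ b, G.Adj x y
  symm := ⟨fun _ _ h => ⟨h.1.symm, fun x hx y hy => (h.2 y hy x hx).symm⟩⟩
  loopless := ⟨fun _ h => h.1 rfl⟩

theorem cone_adj_some {G : SimpleGraph V} {a b : V} :
    (cone G).Adj (some a) (some b) ↔ G.Adj a b := by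
  simp only [cone, ne_eq, Option.some.injEq, Option.mem_def, forall_eq']
  exact ⟨fun h => h.2, fun h => ⟨h.ne, h⟩⟩

theorem cone_adj_none {G : SimpleGraph V} {v : Option V} (hv : v ≠ none) :
    (cone G).Adj none v :=
  ⟨hv.symm, by simp⟩

theorem isChain_cone_map_some {G : SimpleGraph V} {l : List V} :
    (l.map some).IsChain (cone G).Adj ↔ l.IsChain G.Adj := by
  rw [List.isChain_map]
  simp only [cone_adj_some]

theorem exists_isDisjointPaths [Finite V] {G : SimpleGraph V} {x y : V} (hxy : x ≠ y) {N : ℕ}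
    (hN : N ≤ localConn G x y) : ∃ L : Fin N → List V, IsDisjointPaths G x y L := by
  classical
  have := Fintype.ofFinite V
  have hmem : localConn G x y ∈ {n | ∃ P : Set (G.Path x y),
      P.Pairwise (fun p q => InternallyDisjoint G p.1 q.1) ∧ P.ncard = n} := by
    refine Nat.sSup_mem ⟨0, ∅, by simp⟩ ⟨Nat.card (G.Path x y), ?_⟩
    rintro n ⟨P, -, rfl⟩
    exact Set.ncard_le_card P
  obtain ⟨P, hP, hc⟩ := hmem
  obtain ⟨f⟩ : Nonempty (Fin N ↪ P) := by
    have := Fintype.ofFinite P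
    rw [Function.Embedding.nonempty_iff_card_le, Fintype.card_fin, ← Nat.card_eq_fintype_card,
      Nat.card_coe_set_eq, hc]
    exact hN
  choose Q hQ hxQ hyQ hQn hQc using fun i => (f i).1.2.exists_support_eq hxy
  refine ⟨Q, hQc, hQn, hxQ, hyQ, fun i j hij v hv hv' => ?_⟩
  have hne : (f i).1 ≠ (f j).1 := fun h => hij (f.injective (Subtype.ext h))
  rcases hP (f i).2 (f j).2 hne v (by rw [hQ]; simp [hv]) (by rw [hQ]; simp [hv']) with rfl | rfl
  · exact hxQ i hv
  · exact hyQ i hv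

theorem IsDisjointPaths.cone {G : SimpleGraph V} {x y : V} {N : ℕ} {L : Fin N → List V}
    (hL : IsDisjointPaths G x y L) :
    IsDisjointPaths (cone G) (some x) (some y)
      (Fin.cons [none] (fun i => (L i).map some) : Fin (N + 1) → List (Option V)) := by
  refine ⟨?_, ?_, ?_, ?_, ?_⟩
  · refine Fin.cases ?_ fun i => ?_
    · simpa using ⟨(cone_adj_none (by simp)).symm, cone_adj_none (by simp)⟩
    · simpa using isChain_cone_map_some.2 (hL.chain i)
  · refine Fin.cases (by simp) fun i => ?_
    simpa using (hL.nodup i).map (Option.some_injective V)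
  · refine Fin.cases (by simp) fun i => ?_
    simpa using hL.left_notMem i
  · refine Fin.cases (by simp) fun i => ?_
    simpa using hL.right_notMem i
  · refine Fin.cases (Fin.cases (by simp) fun j => ?_) fun i => Fin.cases ?_ fun j => ?_
    · simp
    · simp
    · intro hij
      have := hL.disj i j (by simpa using hij)
      simp only [Fin.cons_succ, List.mem_map]
      rintro _ ⟨a, ha, rfl⟩ ⟨b, hb, hba⟩
      exact this a ha (Option.some_injective V hba ▸ hb)

theorem indepNumOn_cone_le [Finite V] (G : SimpleGraph V) (S : Set V) :
    indepNumOn (cone G) (some '' S) ≤ indepNumOn G S := by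
  obtain ⟨I, hI, hp, hc⟩ := exists_maxIndepOn (cone G) (some '' S)
  obtain ⟨J, hJ, rfl⟩ := Set.subset_image_iff.1 hI
  rw [← hc, Set.ncard_image_of_injective _ (Option.some_injective V)]
  refine indep_ncard_le hJ fun a ha b hb hab h => ?_
  exact hp (mem_image_of_mem _ ha) (mem_image_of_mem _ hb) (by simpa using hab)
    (cone_adj_some.2 h)

theorem indepNumOn_le_cone [Finite V] (G : SimpleGraph V) (S : Set V) :
    indepNumOn G S ≤ indepNumOn (cone G) (some '' S) := by
  obtain ⟨I, hI, hp, hc⟩ := exists_maxIndepOn G S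
  rw [← hc, ← Set.ncard_image_of_injective _ (Option.some_injective V)]
  refine indep_ncard_le (image_mono hI) ?_
  rintro _ ⟨a, ha, rfl⟩ _ ⟨b, hb, rfl⟩ hab h
  exact hp ha hb (fun h => hab (h ▸ rfl)) (cone_adj_some.1 h)

/-- A path of `G` that misses only a set of small independence number in `S`. -/
theorem exists_path_indepNumOn_lt [Finite V] (G : SimpleGraph V) (S : Set V) {m N : ℕ}
    (hm : 1 ≤ m) (hN : ∀ x ∈ S, ∀ y ∈ S, x ≠ y → N ≤ localConn G x y)
    (hα : indepNumOn G S < m + (N + 1)) :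
    ∃ l : List V, l.IsChain G.Adj ∧ l.Nodup ∧ indepNumOn G {v | v ∈ S ∧ v ∉ l} < m := by
  by_contra hcon
  push Not at hcon
  refine absurd (add_le_indepNumOn_of_forall_path (G := cone G) (z := none) (N := N + 1)
    (fun v hv => cone_adj_none hv) hm (some '' S) (by simp) ?_ ?_)
    (not_le.2 ((indepNumOn_cone_le G S).trans_lt hα))
  · rintro _ ⟨x, hx, rfl⟩ _ ⟨y, hy, rfl⟩ hxy
    have hxy' : x ≠ y := fun h => hxy (h ▸ rfl)
    obtain ⟨L, hL⟩ := exists_isDisjointPaths hxy' (hN x hx y hy hxy')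
    exact ⟨_, hL.cone⟩
  · rintro l ⟨h1, h2, h3⟩
    obtain ⟨t, rfl⟩ : ∃ t, l = none :: t := List.head?_eq_some_iff.1 h1
    rw [List.nodup_cons] at h3
    obtain ⟨s, rfl⟩ : t ∈ Set.range (List.map some) := by
      rw [Set.range_list_map]
      intro o ho
      exact Option.ne_none_iff_exists.1 fun h => h3.1 (h ▸ ho)
    refine (hcon s (isChain_cone_map_some.1 h2.tail) (List.Nodup.of_map _ h3.2)).trans
      ((indepNumOn_le_cone G _).trans (indepNumOn_mono ?_))
    rintro _ ⟨v, ⟨hv, hvt⟩, rfl⟩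
    exact ⟨⟨v, hv, rfl⟩, by simpa using hvt⟩

/-- If `G` is connected, `k ≥ 2` and `α_G(S) ≤ k + κ_G(S) - 1`, then `G` has a tree
covering `S` with at most `k - 2` branch vertices. -/
theorem stmt_3 [Fintype V] (G : SimpleGraph V) (hG : G.Connected)
    (k : ℕ) (hk : 2 ≤ k) (S : Set V)
    (hακ : (indepNumOn G S : ℕ∞) + 1 ≤ (k : ℕ∞) + setConn G S) :
    ∃ T : G.Subgraph, T.coe.IsTree ∧ S ⊆ T.verts ∧ (subBranches T).ncard ≤ k - 2 := by
  obtain ⟨N, hN, hα⟩ : ∃ N : ℕ, (N : ℕ∞) ≤ setConn G S ∧ indepNumOn G S + 1 ≤ k + N := by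
    generalize setConn G S = c at hακ ⊢
    induction c using ENat.recTopCoe with
    | top => exact ⟨indepNumOn G S + 1, le_top, by omega⟩
    | coe N => exact ⟨N, le_rfl, by exact_mod_cast hακ⟩
  have hN' : ∀ x ∈ S, ∀ y ∈ S, x ≠ y → N ≤ localConn G x y := by
    intro x hx y hy hxy
    simp only [setConn, le_iInf_iff] at hN
    exact_mod_cast hN x hx y hy hxy
  obtain ⟨l, hc, hn, hl⟩ :=
    exists_path_indepNumOn_lt G S (m := k - 1) (by omega) hN' (by omega)
  obtain ⟨T, hT, hsub, hb⟩ : ∃ T : G.Subgraph, IsSubtree T ∧ {v | v ∈ l} ⊆ T.verts ∧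
      subBranches T = ∅ := by
    cases l with
    | nil =>
      obtain ⟨v⟩ := hG.nonempty
      obtain ⟨T, hT, -, -, hb⟩ := exists_isSubtree_of_path (G := G) v [] (by simp) (by simp)
      exact ⟨T, hT, by simp, hb⟩
    | cons v l =>
      obtain ⟨T, hT, hv, -, hb⟩ := exists_isSubtree_of_path v l hc hn
      exact ⟨T, hT, hv.ge, hb⟩
  obtain ⟨T', hT', hS, hb'⟩ := IsSubtree.exists_cover hG S (k - 2) T hT (by
    have : indepNumOn G (S \ T.verts) ≤ indepNumOn G {v | v ∈ S ∧ v ∉ l} :=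
      indepNumOn_mono fun v hv => ⟨hv.1, fun h => hv.2 (hsub h)⟩
    omega)
  refine ⟨T', hT'.isTree, hS, hb'.trans ?_⟩
  simp [hb]
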